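/- cov*(𝒩) ≥ κ*, i.e. the least cardinality of a family 𝒜 of null subsets of the plane as in the definition of cov*(𝒩) is at least the supremum over f of the dominating numbers of the infinitely-equal relations R^∃_f. -/

import Mathlib

open Cardinal MeasureTheory Set Filter

/-- `cov*(𝒩)`: the least cardinality of a family `𝒜` of null subsets of the plane such that
for every Borel function `f : ℝ → ℝ` and every Borel set `B ⊆ ℝ` of positive Lebesgue measure
there is `H ∈ 𝒜` with `{x ∈ B : (x, f x) ∈ H}` not Lebesgue-null. -/
noncomputable def covStarN : Cardinal :=
  sInf { c : Cardinal | ∃ A : Set (Set (ℝ × ℝ)), #A = c ∧ (∀ H ∈ A, volume H = 0) ∧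
    ∀ f : ℝ → ℝ, Measurable f → ∀ B : Set ℝ, MeasurableSet B → 0 < volume B →
      ∃ H ∈ A, volume {x | x ∈ B ∧ (x, f x) ∈ H} ≠ 0 }

/-- The dominating number of a relation `R ⊆ A × B`. -/
noncomputable def dNumber {A B : Type} (R : A → B → Prop) : Cardinal :=
  sInf { c : Cardinal | ∃ Y : Set B, #Y = c ∧ ∀ x : A, ∃ y ∈ Y, R x y }

/-- The infinitely-equal relation `R^∃_f` on `S_f = ∏ n, f n`. -/
def REx (f : ℕ → ℕ) (η₀ η₁ : ∀ n, Fin (f n)) : Prop := {n | η₀ n = η₁ n}.Infinite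

/-- `κ* = sup { 𝔡(R^∃_f) : f ∈ (ω \ {0})^ω }`. -/
noncomputable def kappaStar : Cardinal :=
  ⨆ f : {f : ℕ → ℕ // ∀ n, 0 < f n}, dNumber (REx f.1)

/-- The Rademacher functions, indexed so that all of them have period `1`. -/
noncomputable def rademacher (n : ℕ) (t : ℝ) : ℝ := (-1) ^ ⌊2 ^ (n + 1) * t⌋

theorem measurable_rademacher (n : ℕ) : Measurable (rademacher n) :=
  (measurable_from_top (f := fun m : ℤ => (-1 : ℝ) ^ m)).comp
    (Int.measurable_floor.comp (measurable_const_mul _))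

theorem rademacher_eq_or (n : ℕ) (t : ℝ) : rademacher n t = 1 ∨ rademacher n t = -1 := by
  unfold rademacher
  rcases Int.even_or_odd ⌊2 ^ (n + 1) * t⌋ with h | h
  · exact Or.inl h.neg_one_zpow
  · exact Or.inr h.neg_one_zpow

theorem rademacher_mul_self (n : ℕ) (t : ℝ) : rademacher n t * rademacher n t = 1 := by
  rcases rademacher_eq_or n t with h | h <;> simp [h]

theorem abs_rademacher (n : ℕ) (t : ℝ) : |rademacher n t| = 1 := by
  rcases rademacher_eq_or n t with h | h <;> simp [h]

theorem rademacher_add_of_lt {i j : ℕ} (h : i < j) (t : ℝ) :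
    rademacher j (t + (1 / 2) ^ (i + 1)) = rademacher j t := by
  have h1 : (2 : ℝ) ^ (j + 1) * (t + (1 / 2) ^ (i + 1)) =
      2 ^ (j + 1) * t + ((2 ^ (j - i) : ℕ) : ℝ) := by
    obtain ⟨d, rfl⟩ := Nat.exists_eq_add_of_lt h
    rw [show i + d + 1 - i = d + 1 by omega]
    push_cast
    rw [mul_add, div_pow, one_pow]
    field_simp
    ring
  have h2 : Even ((2 ^ (j - i) : ℕ) : ℤ) := by
    have : j - i ≠ 0 := by omega
    exact_mod_cast (even_two.pow_of_ne_zero this)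
  rw [rademacher, rademacher, h1, Int.floor_add_natCast, zpow_add₀ (by norm_num),
    h2.neg_one_zpow, mul_one]

theorem rademacher_add_self (i : ℕ) (t : ℝ) :
    rademacher i (t + (1 / 2) ^ (i + 1)) = -rademacher i t := by
  have h1 : (2 : ℝ) ^ (i + 1) * (t + (1 / 2) ^ (i + 1)) = 2 ^ (i + 1) * t + 1 := by
    rw [mul_add, div_pow, one_pow]
    field_simp
  rw [rademacher, rademacher, h1, Int.floor_add_one, zpow_add₀ (by norm_num)]
  simp

theorem rademacher_periodic (i : ℕ) : Function.Periodic (rademacher i) 1 := by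
  intro t
  have h1 : (2 : ℝ) ^ (i + 1) * (t + 1) = 2 ^ (i + 1) * t + ((2 ^ (i + 1) : ℕ) : ℝ) := by
    push_cast; ring
  have h2 : Even ((2 ^ (i + 1) : ℕ) : ℤ) := by
    exact_mod_cast (even_two.pow_of_ne_zero (Nat.succ_ne_zero i))
  rw [rademacher, rademacher, h1, Int.floor_add_natCast, zpow_add₀ (by norm_num),
    h2.neg_one_zpow, mul_one]

theorem integral_rademacher_mul_of_lt {i j : ℕ} (h : i < j) :
    ∫ t in Ioc (0 : ℝ) 1, rademacher i t * rademacher j t = 0 := by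
  rw [← intervalIntegral.integral_of_le zero_le_one]
  have hper : Function.Periodic (fun t => rademacher i t * rademacher j t) 1 :=
    (rademacher_periodic i).mul (rademacher_periodic j)
  have h1 := hper.intervalIntegral_add_eq 0 ((1 / 2) ^ (i + 1))
  have h2 := intervalIntegral.integral_comp_add_right (a := 0) (b := 1)
    (fun t => rademacher i t * rademacher j t) ((1 / 2) ^ (i + 1))
  simp only [rademacher_add_self, rademacher_add_of_lt h, neg_mul,
    intervalIntegral.integral_neg] at h2
  rw [zero_add] at h1 h2
  rw [add_comm (1 : ℝ)] at h2
  linarith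

theorem integral_rademacher_mul (i j : ℕ) :
    ∫ t in Ioc (0 : ℝ) 1, rademacher i t * rademacher j t = if i = j then 1 else 0 := by
  split_ifs with h
  · subst h
    simp [rademacher_mul_self]
  · rcases lt_or_gt_of_ne h with h | h
    · exact integral_rademacher_mul_of_lt h
    · simpa only [mul_comm] using integral_rademacher_mul_of_lt h

theorem integrableOn_Ioc_of_abs_le {g : ℝ → ℝ} (hg : Measurable g) {C : ℝ} (hC : ∀ t, |g t| ≤ C) :
    IntegrableOn g (Ioc 0 1) :=
  Integrable.of_bound hg.aestronglyMeasurable C (Eventually.of_forall hC)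

/-- Bessel's inequality in the form of a bound on the number of large Rademacher coefficients. -/
theorem card_mul_sq_le_one_of_lt_integral_rademacher {D : ℝ → ℝ} (hD : Measurable D)
    (hD1 : ∀ t, |D t| ≤ 1) {δ : ℝ} (hδ : 0 ≤ δ) (T : Finset ℕ)
    (hT : ∀ m ∈ T, δ < ∫ t in Ioc (0 : ℝ) 1, rademacher m t * D t) : T.card * δ ^ 2 ≤ 1 := by
  have hrr : ∀ i j, IntegrableOn (fun t => rademacher i t * rademacher j t) (Ioc 0 1) := fun i j =>
    integrableOn_Ioc_of_abs_le ((measurable_rademacher i).mul (measurable_rademacher j)) (C := 1)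
      fun t => by simp [abs_mul, abs_rademacher]
  have hrD : ∀ i, IntegrableOn (fun t => rademacher i t * D t) (Ioc 0 1) := fun i =>
    integrableOn_Ioc_of_abs_le ((measurable_rademacher i).mul hD) (C := 1)
      fun t => by simpa [abs_mul, abs_rademacher] using hD1 t
  have hDD : IntegrableOn (fun t => D t ^ 2) (Ioc 0 1) :=
    integrableOn_Ioc_of_abs_le (hD.pow_const 2) (C := 1)
      fun t => by rw [abs_pow]; exact pow_le_one₀ (abs_nonneg _) (hD1 t)
  have hDD1 : ∫ t in Ioc (0 : ℝ) 1, D t ^ 2 ≤ 1 := by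
    calc ∫ t in Ioc (0 : ℝ) 1, D t ^ 2 ≤ ∫ t in Ioc (0 : ℝ) 1, (1 : ℝ) :=
          integral_mono hDD (by simp) fun t => (sq_le_one_iff_abs_le_one _).2 (hD1 t)
      _ = 1 := by simp
  have hexp : ∀ t, (D t - δ * ∑ m ∈ T, rademacher m t) ^ 2 =
      D t ^ 2 - 2 * δ * ∑ m ∈ T, rademacher m t * D t +
        δ ^ 2 * ∑ i ∈ T, ∑ j ∈ T, rademacher i t * rademacher j t := by
    intro t
    rw [← Finset.sum_mul_sum, ← Finset.sum_mul]
    ring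
  have h0 : 0 ≤ ∫ t in Ioc (0 : ℝ) 1, (D t - δ * ∑ m ∈ T, rademacher m t) ^ 2 :=
    integral_nonneg fun t => sq_nonneg _
  simp only [hexp] at h0
  have hi1 : IntegrableOn (fun t => 2 * δ * ∑ m ∈ T, rademacher m t * D t) (Ioc 0 1) :=
    (integrable_finsetSum T fun m _ => hrD m).const_mul _
  have hi2 : IntegrableOn
      (fun t => δ ^ 2 * ∑ i ∈ T, ∑ j ∈ T, rademacher i t * rademacher j t) (Ioc 0 1) :=
    (integrable_finsetSum T fun i _ => integrable_finsetSum T fun j _ => hrr i j).const_mul _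
  have hi3 : IntegrableOn (fun t => D t ^ 2 - 2 * δ * ∑ m ∈ T, rademacher m t * D t) (Ioc 0 1) :=
    hDD.sub hi1
  rw [integral_add hi3 hi2, integral_sub hDD hi1, integral_const_mul, integral_const_mul,
    integral_finsetSum T fun m _ => hrD m,
    integral_finsetSum T fun i _ => integrable_finsetSum T fun j _ => hrr i j] at h0
  have hsum : ∑ i ∈ T, ∫ t in Ioc (0 : ℝ) 1, ∑ j ∈ T, rademacher i t * rademacher j t
      = T.card := by
    rw [Finset.card_eq_sum_ones, Nat.cast_sum]
    refine Finset.sum_congr rfl fun i hi => ?_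
    rw [integral_finsetSum T fun j _ => hrr i j]
    simp [integral_rademacher_mul, hi]
  rw [hsum] at h0
  have hlow : T.card * δ ≤ ∑ m ∈ T, ∫ t in Ioc (0 : ℝ) 1, rademacher m t * D t := by
    rw [← nsmul_eq_mul]
    exact Finset.card_nsmul_le_sum T _ _ fun m hm => (hT m hm).le
  nlinarith [mul_le_mul_of_nonneg_left hlow hδ]

/-- The relative measure, in the interval of length `2 ^ (-k)` starting at `s t`, of the vertical
section of `U` at `t`. -/
noncomputable def sectionDensity (U : Set (ℝ × ℝ)) (s : ℝ → ℝ) (k : ℕ) (t : ℝ) : ℝ :=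
  2 ^ k * volume.real (Prod.mk t ⁻¹' U ∩ Ico (s t) (s t + (1 / 2) ^ k))

section sectionDensity

variable {U : Set (ℝ × ℝ)} {s : ℝ → ℝ}

theorem measurable_sectionDensity (hU : MeasurableSet U) (hs : Measurable s) (k : ℕ) :
    Measurable (sectionDensity U s k) := by
  have hm : MeasurableSet (U ∩ {p : ℝ × ℝ | s p.1 ≤ p.2 ∧ p.2 < s p.1 + (1 / 2) ^ k}) :=
    hU.inter ((measurableSet_le (hs.comp measurable_fst) measurable_snd).inter
      (measurableSet_lt measurable_snd ((hs.comp measurable_fst).add_const _)))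
  exact ((measurable_measure_prodMk_left (ν := volume) hm).ennreal_toReal).const_mul _

theorem sectionDensity_nonneg (k : ℕ) (t : ℝ) : 0 ≤ sectionDensity U s k t := by
  unfold sectionDensity; positivity

theorem volume_inter_Ico_ne_top (A : Set ℝ) (a b : ℝ) : volume (A ∩ Ico a b) ≠ ⊤ :=
  measure_ne_top_of_subset inter_subset_right (by simp)

theorem sectionDensity_of_subset {k : ℕ} {t : ℝ}
    (h : Ico (s t) (s t + (1 / 2) ^ k) ⊆ Prod.mk t ⁻¹' U) : sectionDensity U s k t = 1 := by
  rw [sectionDensity, inter_eq_right.2 h, Real.volume_real_Ico_of_le (by simp)]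
  simp

theorem sectionDensity_le_one (k : ℕ) (t : ℝ) : sectionDensity U s k t ≤ 1 := by
  rw [← sectionDensity_of_subset (U := univ) (s := s) (k := k) (t := t) (by simp)]
  unfold sectionDensity
  gcongr
  · exact volume_inter_Ico_ne_top _ _ _
  · exact subset_univ _

theorem abs_sectionDensity_le_one (k : ℕ) (t : ℝ) : |sectionDensity U s k t| ≤ 1 := by
  rw [abs_of_nonneg (sectionDensity_nonneg k t)]
  exact sectionDensity_le_one k t

theorem sectionDensity_eq_average (hU : MeasurableSet U) (k : ℕ) (t : ℝ) :
    sectionDensity U s k t = (sectionDensity U s (k + 1) t +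
      sectionDensity U (fun t => s t + (1 / 2) ^ (k + 1)) (k + 1) t) / 2 := by
  have hUt : MeasurableSet (Prod.mk t ⁻¹' U) := measurable_prodMk_left hU
  have h2 : s t + (1 / 2) ^ k = s t + (1 / 2) ^ (k + 1) + (1 / 2) ^ (k + 1) := by ring
  simp only [sectionDensity]
  rw [h2, ← Ico_union_Ico_eq_Ico (a := s t) (b := s t + (1 / 2) ^ (k + 1)) (by simp) (by simp),
    inter_union_distrib_left,
    measureReal_union (Ico_disjoint_Ico_same.mono inter_subset_right inter_subset_right)
      (hUt.inter measurableSet_Ico) (volume_inter_Ico_ne_top _ _ _) (volume_inter_Ico_ne_top _ _ _)]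
  ring

theorem integral_sectionDensity_le (hU : MeasurableSet U) (hfin : volume U ≠ ⊤)
    (hs : Measurable s) (k : ℕ) :
    ∫ t in Ioc (0 : ℝ) 1, sectionDensity U s k t ≤ 2 ^ k * (volume U).toReal := by
  have hi : IntegrableOn (sectionDensity U s k) (Ioc 0 1) :=
    integrableOn_Ioc_of_abs_le (measurable_sectionDensity hU hs k) (abs_sectionDensity_le_one k)
  have hle : ENNReal.ofReal (∫ t in Ioc (0 : ℝ) 1, sectionDensity U s k t) ≤
      2 ^ k * volume U := by
    rw [ofReal_integral_eq_lintegral_ofReal hi (Eventually.of_forall (sectionDensity_nonneg k)),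
      Measure.volume_eq_prod, Measure.prod_apply hU,
      ← lintegral_const_mul _ (measurable_measure_prodMk_left hU)]
    refine (lintegral_mono fun t => ?_).trans (setLIntegral_le_lintegral _ _)
    rw [sectionDensity, ENNReal.ofReal_mul (by positivity),
      ofReal_measureReal (volume_inter_Ico_ne_top _ _ _), ENNReal.ofReal_pow (by norm_num),
      ENNReal.ofReal_ofNat]
    gcongr
    exact inter_subset_left
  have := (ENNReal.ofReal_le_iff_le_toReal (by finiteness)).1 hle
  simpa using this

end sectionDensity

/-- Half the difference of the densities of the section on the right and left halves of an
interval of length `2 ^ (-k)`. -/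
noncomputable def halfDiff (U : Set (ℝ × ℝ)) (s : ℝ → ℝ) (k : ℕ) (t : ℝ) : ℝ :=
  (sectionDensity U s (k + 1) t -
    sectionDensity U (fun t => s t + (1 / 2) ^ (k + 1)) (k + 1) t) / 2

theorem measurable_halfDiff {U : Set (ℝ × ℝ)} {s : ℝ → ℝ} (hU : MeasurableSet U)
    (hs : Measurable s) (k : ℕ) : Measurable (halfDiff U s k) :=
  ((measurable_sectionDensity hU hs _).sub
    (measurable_sectionDensity hU (hs.add_const _) _)).div_const _

theorem abs_halfDiff_le_one (U : Set (ℝ × ℝ)) (s : ℝ → ℝ) (k : ℕ) (t : ℝ) :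
    |halfDiff U s k t| ≤ 1 := by
  have h1 := sectionDensity_nonneg (U := U) (s := s) (k + 1) t
  have h2 := sectionDensity_le_one (U := U) (s := s) (k + 1) t
  have h3 := sectionDensity_nonneg (U := U) (s := fun t => s t + (1 / 2) ^ (k + 1)) (k + 1) t
  have h4 := sectionDensity_le_one (U := U) (s := fun t => s t + (1 / 2) ^ (k + 1)) (k + 1) t
  rw [abs_le]
  constructor <;> unfold halfDiff <;> linarith

/-- The number whose first `k` binary digits are read off from the signs of the Rademacher
functions with indices `β 0, …, β (k - 1)`. -/
noncomputable def dyadicApprox (β : ℕ → ℕ) (k : ℕ) (t : ℝ) : ℝ :=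
  ∑ j ∈ Finset.range k, (1 - rademacher (β j) t) / 2 * (1 / 2) ^ (j + 1)

/-- The number whose binary digits are read off from the signs of the Rademacher functions with
indices `β 0, β 1, …`. -/
noncomputable def dyadicLimit (β : ℕ → ℕ) (t : ℝ) : ℝ := ⨆ k, dyadicApprox β k t

section dyadic

variable (β : ℕ → ℕ)

theorem measurable_dyadicApprox (k : ℕ) : Measurable (dyadicApprox β k) :=
  Finset.measurable_fun_sum _ fun j _ =>
    (((measurable_rademacher (β j)).const_sub 1).div_const 2).mul_const _

theorem measurable_dyadicLimit : Measurable (dyadicLimit β) :=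
  Measurable.iSup fun k => measurable_dyadicApprox β k

theorem dyadicApprox_succ (k : ℕ) (t : ℝ) : dyadicApprox β (k + 1) t =
    dyadicApprox β k t + (1 - rademacher (β k) t) / 2 * (1 / 2) ^ (k + 1) :=
  Finset.sum_range_succ _ _

theorem monotone_dyadicApprox (t : ℝ) : Monotone fun k => dyadicApprox β k t := by
  refine monotone_nat_of_le_succ fun k => ?_
  simp only [dyadicApprox_succ]
  rcases rademacher_eq_or (β k) t with h | h <;> simp [h]

theorem antitone_dyadicApprox_add (t : ℝ) :
    Antitone fun k => dyadicApprox β k t + (1 / 2) ^ k := by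
  refine antitone_nat_of_succ_le fun k => ?_
  have hp : (0 : ℝ) < (1 / 2) ^ k := by positivity
  simp only [dyadicApprox_succ, pow_succ]
  rcases rademacher_eq_or (β k) t with h | h <;> rw [h] <;> linarith

theorem dyadicApprox_le_add (j k : ℕ) (t : ℝ) :
    dyadicApprox β j t ≤ dyadicApprox β k t + (1 / 2) ^ k := by
  have h1 := monotone_dyadicApprox β t (le_max_left j k)
  have h2 := antitone_dyadicApprox_add β t (le_max_right j k)
  have hp : (0 : ℝ) < (1 / 2) ^ max j k := by positivity
  dsimp only at h1 h2
  linarith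

theorem dyadicApprox_le_dyadicLimit (k : ℕ) (t : ℝ) : dyadicApprox β k t ≤ dyadicLimit β t :=
  le_ciSup (f := fun k => dyadicApprox β k t)
    ⟨_, by rintro _ ⟨j, rfl⟩; exact dyadicApprox_le_add β j 0 t⟩ k

theorem dyadicLimit_le (k : ℕ) (t : ℝ) : dyadicLimit β t ≤ dyadicApprox β k t + (1 / 2) ^ k :=
  ciSup_le fun j => dyadicApprox_le_add β j k t

theorem dyadicApprox_congr {β γ : ℕ → ℕ} {k : ℕ} (h : ∀ j < k, β j = γ j) :
    dyadicApprox β k = dyadicApprox γ k := by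
  funext t
  exact Finset.sum_congr rfl fun j hj => by rw [h j (Finset.mem_range.1 hj)]

theorem sectionDensity_dyadicApprox_succ {U : Set (ℝ × ℝ)} (hU : MeasurableSet U) (k : ℕ)
    (t : ℝ) : sectionDensity U (dyadicApprox β (k + 1)) (k + 1) t =
      sectionDensity U (dyadicApprox β k) k t +
        rademacher (β k) t * halfDiff U (dyadicApprox β k) k t := by
  rw [sectionDensity_eq_average (s := dyadicApprox β k) hU, halfDiff]
  rcases rademacher_eq_or (β k) t with h | h
  · have h1 : dyadicApprox β (k + 1) t = dyadicApprox β k t := by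
      rw [dyadicApprox_succ, h]; ring
    have h2 : sectionDensity U (dyadicApprox β (k + 1)) (k + 1) t =
        sectionDensity U (dyadicApprox β k) (k + 1) t := by simp only [sectionDensity, h1]
    rw [h2, h]; ring
  · have h1 : dyadicApprox β (k + 1) t = dyadicApprox β k t + (1 / 2) ^ (k + 1) := by
      rw [dyadicApprox_succ, h]; ring
    have h2 : sectionDensity U (dyadicApprox β (k + 1)) (k + 1) t =
        sectionDensity U (fun t => dyadicApprox β k t + (1 / 2) ^ (k + 1)) (k + 1) t := by
      simp only [sectionDensity, h1]
    rw [h2, h]; ring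

theorem integral_sectionDensity_dyadicApprox_succ {U : Set (ℝ × ℝ)} (hU : MeasurableSet U)
    (k : ℕ) : ∫ t in Ioc (0 : ℝ) 1, sectionDensity U (dyadicApprox β (k + 1)) (k + 1) t =
      (∫ t in Ioc (0 : ℝ) 1, sectionDensity U (dyadicApprox β k) k t) +
        ∫ t in Ioc (0 : ℝ) 1, rademacher (β k) t * halfDiff U (dyadicApprox β k) k t := by
  have hs := measurable_dyadicApprox β k
  simp only [sectionDensity_dyadicApprox_succ β hU]
  refine integral_add (integrableOn_Ioc_of_abs_le (measurable_sectionDensity hU hs k)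
    (abs_sectionDensity_le_one k)) (integrableOn_Ioc_of_abs_le
      ((measurable_rademacher _).mul (measurable_halfDiff hU hs k)) (C := 1) fun t => ?_)
  simpa [abs_mul, abs_rademacher] using abs_halfDiff_le_one U _ k t

theorem integral_sectionDensity_dyadicApprox_le {U : Set (ℝ × ℝ)} (hU : MeasurableSet U) (a : ℕ)
    (hgood : ∀ k, a ≤ k →
      ∫ t in Ioc (0 : ℝ) 1, rademacher (β k) t * halfDiff U (dyadicApprox β k) k t ≤ (1 / 2) ^ k)
    {k : ℕ} (hk : a ≤ k) :
    ∫ t in Ioc (0 : ℝ) 1, sectionDensity U (dyadicApprox β k) k t ≤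
      (∫ t in Ioc (0 : ℝ) 1, sectionDensity U (dyadicApprox β a) a t) +
        2 * ((1 / 2) ^ a - (1 / 2) ^ k) := by
  induction k, hk using Nat.le_induction with
  | base => simp
  | succ k hk ih =>
    rw [integral_sectionDensity_dyadicApprox_succ β hU]
    have := hgood k hk
    rw [pow_succ]
    linarith

theorem eventually_sectionDensity_eq_one {U : Set (ℝ × ℝ)} (hU : IsOpen U) {t : ℝ}
    (ht : (t, dyadicLimit β t) ∈ U) :
    ∀ᶠ k in atTop, sectionDensity U (dyadicApprox β k) k t = 1 := by
  have hUt : IsOpen (Prod.mk t ⁻¹' U) := hU.preimage (by fun_prop)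
  obtain ⟨ε, hε, hball⟩ := Metric.isOpen_iff.1 hUt _ ht
  have hlim : ∀ᶠ k : ℕ in atTop, ((1 : ℝ) / 2) ^ k < ε :=
    (tendsto_pow_atTop_nhds_zero_of_lt_one (by norm_num) (by norm_num)).eventually_lt_const hε
  filter_upwards [hlim] with k hk
  refine sectionDensity_of_subset fun z hz => hball ?_
  have h1 := dyadicApprox_le_dyadicLimit β k t
  have h2 := dyadicLimit_le β k t
  rw [Metric.mem_ball, Real.dist_eq, abs_lt]
  constructor <;> linarith [hz.1, hz.2]

theorem volume_dyadicLimit_mem_le {U : Set (ℝ × ℝ)} (hU : IsOpen U) {C : ℝ}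
    (hC : ∀ᶠ k in atTop, ∫ t in Ioc (0 : ℝ) 1, sectionDensity U (dyadicApprox β k) k t ≤ C) :
    volume {t | t ∈ Ioc (0 : ℝ) 1 ∧ (t, dyadicLimit β t) ∈ U} ≤ ENNReal.ofReal C := by
  set E : Set ℝ := {t | t ∈ Ioc (0 : ℝ) 1 ∧ (t, dyadicLimit β t) ∈ U}
  have hE : MeasurableSet E := measurableSet_Ioc.inter
    ((measurable_id.prodMk (measurable_dyadicLimit β)) hU.measurableSet)
  have hm := fun k => (measurable_sectionDensity hU.measurableSet (measurable_dyadicApprox β k) k)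
  calc volume E = ∫⁻ t in Ioc (0 : ℝ) 1, E.indicator 1 t := by
        rw [lintegral_indicator_one hE, Measure.restrict_apply hE]
        congr 1
        exact (inter_eq_left.2 fun t ht => ht.1).symm
    _ ≤ ∫⁻ t in Ioc (0 : ℝ) 1,
          liminf (fun k => ENNReal.ofReal (sectionDensity U (dyadicApprox β k) k t)) atTop := by
        refine lintegral_mono (indicator_le fun t ht => ?_)
        refine le_liminf_of_le (by isBoundedDefault) ?_
        filter_upwards [eventually_sectionDensity_eq_one β hU ht.2] with k hk
        simp [hk]
    _ ≤ liminf (fun k => ∫⁻ t in Ioc (0 : ℝ) 1,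
          ENNReal.ofReal (sectionDensity U (dyadicApprox β k) k t)) atTop :=
        lintegral_liminf_le fun k => (hm k).ennreal_ofReal
    _ ≤ ENNReal.ofReal C := by
        refine liminf_le_of_frequently_le' (Eventually.frequently ?_)
        filter_upwards [hC] with k hk
        rw [← ofReal_integral_eq_lintegral_ofReal
          (integrableOn_Ioc_of_abs_le (hm k) (abs_sectionDensity_le_one k))
          (Eventually.of_forall (sectionDensity_nonneg k))]
        exact ENNReal.ofReal_le_ofReal hk

theorem volume_dyadicLimit_mem_eq_zero {H : Set (ℝ × ℝ)} {U : ℕ → Set (ℝ × ℝ)}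
    (hU : ∀ a, IsOpen (U a)) (hHU : ∀ a, H ⊆ U a)
    (hvol : ∀ a, volume (U a) < ENNReal.ofReal ((1 / 4) ^ a)) (k₀ : ℕ)
    (hgood : ∀ k, k₀ ≤ k → ∀ a ≤ k,
      ∫ t in Ioc (0 : ℝ) 1, rademacher (β k) t * halfDiff (U a) (dyadicApprox β k) k t ≤
        (1 / 2) ^ k) :
    volume {t | t ∈ Ioc (0 : ℝ) 1 ∧ (t, dyadicLimit β t) ∈ H} = 0 := by
  have hbound : ∀ a, k₀ ≤ a → volume {t | t ∈ Ioc (0 : ℝ) 1 ∧ (t, dyadicLimit β t) ∈ H} ≤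
      ENNReal.ofReal (3 * (1 / 2) ^ a) := by
    intro a ha
    refine (measure_mono fun t (ht : _ ∧ _) => And.intro ht.1 (hHU a ht.2)).trans
      (volume_dyadicLimit_mem_le β (hU a) ?_)
    filter_upwards [eventually_ge_atTop a] with k hk
    have h1 := integral_sectionDensity_dyadicApprox_le β (hU a).measurableSet a
      (fun k hk => hgood k (ha.trans hk) a hk) hk
    have h2 := integral_sectionDensity_le (hU a).measurableSet (hvol a).ne_top
      (measurable_dyadicApprox β a) a
    have h3 : (volume (U a)).toReal ≤ (1 / 4) ^ a :=
      ENNReal.toReal_le_of_le_ofReal (by positivity) (hvol a).le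
    have h4 : (2 : ℝ) ^ a * (volume (U a)).toReal ≤ (1 / 2) ^ a := by
      calc (2 : ℝ) ^ a * (volume (U a)).toReal ≤ 2 ^ a * (1 / 4) ^ a := by gcongr
        _ = (1 / 2) ^ a := by rw [← mul_pow]; norm_num
    have hp : (0 : ℝ) < (1 / 2) ^ k := by positivity
    linarith
  have hlim : Tendsto (fun a : ℕ => ENNReal.ofReal (3 * (1 / 2) ^ a)) atTop (nhds 0) := by
    rw [← ENNReal.ofReal_zero]
    refine ENNReal.tendsto_ofReal ?_
    simpa using (tendsto_pow_atTop_nhds_zero_of_lt_one (r := (1 / 2 : ℝ)) (by norm_num)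
      (by norm_num)).const_mul 3
  refine le_antisymm (ge_of_tendsto hlim ?_) zero_le
  filter_upwards [eventually_ge_atTop k₀] with a ha using hbound a ha

end dyadic

/-- The starting points of successive blocks of `ℕ`, where the length of a block is chosen in terms
of the number of restrictions of members of `∏ n, f n` to the previous blocks. -/
def blockStart (f : ℕ → ℕ) : ℕ → ℕ
  | 0 => 0
  | k + 1 => blockStart f k + (k + 1) * (∏ j : Fin (blockStart f k), f j) * 4 ^ k

section block

variable {f : ℕ → ℕ}

theorem strictMono_blockStart (hf : ∀ n, 0 < f n) : StrictMono (blockStart f) := by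
  refine strictMono_nat_of_lt_succ fun k => ?_
  have : 0 < ∏ j : Fin (blockStart f k), f j := Finset.prod_pos fun j _ => hf j
  rw [blockStart]
  exact Nat.lt_add_of_pos_right (by positivity)

/-- A code for the restriction of `η` to the first `k + 1` blocks. -/
def blockCode (η : ∀ n, Fin (f n)) (k : ℕ) : ℕ :=
  Encodable.encode fun j : Fin (blockStart f (k + 1)) => η j

theorem blockCode_eq_iff {η η' : ∀ n, Fin (f n)} {k : ℕ} :
    blockCode η k = blockCode η' k ↔ ∀ p < blockStart f (k + 1), η p = η' p := by
  rw [blockCode, blockCode, Encodable.encode_inj, funext_iff]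
  exact ⟨fun h p hp => h ⟨p, hp⟩, fun h p => h p p.2⟩

theorem exists_forall_blockCode_mem_imp_eq (hf : ∀ n, 0 < f n) (W : ℕ → Finset ℕ)
    (hW : ∀ k, blockStart f k + (W k).card ≤ blockStart f (k + 1)) :
    ∃ y : ∀ n, Fin (f n), ∀ (η : ∀ n, Fin (f n)) (k : ℕ), blockCode η k ∈ W k →
      ∃ p, blockStart f k ≤ p ∧ η p = y p := by
  have hmono := (strictMono_blockStart hf).monotone
  have key : ∀ p, ∃ v : Fin (f p), ∀ (η : ∀ n, Fin (f n)) (k : ℕ) (h : blockCode η k ∈ W k),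
      p = blockStart f k + (W k).equivFin ⟨_, h⟩ → η p = v := by
    intro p
    by_cases hp : ∃ (η : ∀ n, Fin (f n)) (k : ℕ) (h : blockCode η k ∈ W k),
        p = blockStart f k + (W k).equivFin ⟨_, h⟩
    · obtain ⟨η', k', h', hp'⟩ := hp
      refine ⟨η' p, fun η k h hp => ?_⟩
      have hlt : p < blockStart f (k + 1) := by
        have := ((W k).equivFin ⟨_, h⟩).2
        have := hW k
        omega
      have hlt' : p < blockStart f (k' + 1) := by
        have := ((W k').equivFin ⟨_, h'⟩).2
        have := hW k'
        omega
      obtain rfl : k = k' := by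
        by_contra hne
        rcases lt_or_gt_of_ne hne with hk | hk
        · have := hmono (Nat.succ_le_of_lt hk)
          simp only [Nat.succ_eq_add_one] at this
          omega
        · have := hmono (Nat.succ_le_of_lt hk)
          simp only [Nat.succ_eq_add_one] at this
          omega
      have heq : (W k).equivFin ⟨_, h⟩ = (W k).equivFin ⟨_, h'⟩ := Fin.ext (by omega)
      have hcode := congrArg Subtype.val ((W k).equivFin.injective heq)
      exact blockCode_eq_iff.1 hcode p hlt
    · exact ⟨⟨0, hf p⟩, fun η k h hp' => absurd ⟨η, k, h, hp'⟩ hp⟩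
  choose y hy using key
  exact ⟨y, fun η k h => ⟨_, Nat.le_add_right _ _, hy _ η k h rfl⟩⟩

/-- A member of `∏ n, f n` with a given initial segment. -/
def extendByZero (hf : ∀ n, 0 < f n) {n : ℕ} (σ : ∀ j : Fin n, Fin (f j)) (p : ℕ) : Fin (f p) :=
  if h : p < n then σ ⟨p, h⟩ else ⟨0, hf p⟩

theorem dyadicApprox_blockCode_extendByZero (hf : ∀ n, 0 < f n) (η : ∀ n, Fin (f n)) (k : ℕ) :
    dyadicApprox (blockCode (extendByZero hf fun j : Fin (blockStart f k) => η j)) k =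
      dyadicApprox (blockCode η) k := by
  refine dyadicApprox_congr fun j hj => blockCode_eq_iff.2 fun p hp => ?_
  have := (strictMono_blockStart hf).monotone (Nat.succ_le_of_lt hj)
  exact dif_pos (hp.trans_le this)

theorem exists_finset_blockCode_mem (hf : ∀ n, 0 < f n) {U : ℕ → Set (ℝ × ℝ)}
    (hU : ∀ a, MeasurableSet (U a)) (k : ℕ) :
    ∃ W : Finset ℕ, blockStart f k + W.card ≤ blockStart f (k + 1) ∧
      ∀ η : ∀ n, Fin (f n), ∀ a ≤ k, (1 / 2) ^ k < ∫ t in Ioc (0 : ℝ) 1,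
        rademacher (blockCode η k) t * halfDiff (U a) (dyadicApprox (blockCode η) k) k t →
        blockCode η k ∈ W := by
  classical
  let I (a : ℕ) (σ : ∀ j : Fin (blockStart f k), Fin (f j)) (m : ℕ) : ℝ :=
    ∫ t in Ioc (0 : ℝ) 1, rademacher m t *
      halfDiff (U a) (dyadicApprox (blockCode (extendByZero hf σ)) k) k t
  let codes : Finset ℕ := Finset.univ.image
    fun τ : ∀ j : Fin (blockStart f (k + 1)), Fin (f j) => Encodable.encode τ
  let W : Finset ℕ := (Finset.range (k + 1) ×ˢ Finset.univ).biUnion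
    fun q : ℕ × ∀ j : Fin (blockStart f k), Fin (f j) =>
      codes.filter fun m => (1 / 2) ^ k < I q.1 q.2 m
  refine ⟨W, ?_, fun η a ha h => ?_⟩
  · rw [blockStart]
    refine Nat.add_le_add_left ((Finset.card_biUnion_le_card_mul _ _ (4 ^ k) ?_).trans ?_) _
    · rintro ⟨a, σ⟩ -
      have h := card_mul_sq_le_one_of_lt_integral_rademacher
        (measurable_halfDiff (hU a) (measurable_dyadicApprox (blockCode (extendByZero hf σ)) k) k)
        (abs_halfDiff_le_one _ _ _) (δ := (1 / 2) ^ k) (by positivity)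
        (codes.filter fun m => (1 / 2) ^ k < I a σ m) (fun m hm => (Finset.mem_filter.1 hm).2)
      have h4 : (((1 : ℝ) / 2) ^ k) ^ 2 = 1 / 4 ^ k := by
        rw [← pow_mul, mul_comm, pow_mul, ← one_div_pow]; norm_num
      rw [h4, mul_one_div, div_le_one (by positivity)] at h
      exact_mod_cast h
    · simp [Fintype.card_pi]
  · refine Finset.mem_biUnion.2 ⟨(a, fun j => η j), by simp; omega, Finset.mem_filter.2
      ⟨Finset.mem_image.2 ⟨fun j => η j, Finset.mem_univ _, rfl⟩, ?_⟩⟩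
    simpa only [I, dyadicApprox_blockCode_extendByZero] using h

/-- Each null subset of the plane is evaded by the functions coding those members of `∏ n, f n`
that are eventually different from a suitable one. -/
theorem exists_forall_not_REx_imp_volume_eq_zero (hf : ∀ n, 0 < f n) {H : Set (ℝ × ℝ)}
    (hH : volume H = 0) : ∃ y : ∀ n, Fin (f n), ∀ η : ∀ n, Fin (f n), ¬REx f η y →
      volume {t | t ∈ Ioc (0 : ℝ) 1 ∧ (t, dyadicLimit (blockCode η) t) ∈ H} = 0 := by
  have hex : ∀ a : ℕ, ∃ U ⊇ H, IsOpen U ∧ volume U < ENNReal.ofReal ((1 / 4) ^ a) := fun a =>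
    exists_isOpen_lt_of_lt H _ (by rw [hH]; positivity)
  choose U hHU hU hvol using hex
  choose W hcard hW using exists_finset_blockCode_mem hf fun a => (hU a).measurableSet
  obtain ⟨y, hy⟩ := exists_forall_blockCode_mem_imp_eq hf W hcard
  refine ⟨y, fun η hη => ?_⟩
  obtain ⟨N, hN⟩ := (not_infinite.1 hη).bddAbove
  refine volume_dyadicLimit_mem_eq_zero _ hU hHU hvol (N + 1) fun k hk a ha => ?_
  by_contra! hbad
  obtain ⟨p, hp, hηp⟩ := hy η k (hW k η a ha hbad)
  have h1 := (strictMono_blockStart hf).le_apply (x := k)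
  have h2 : p ≤ N := hN hηp
  omega

end block

theorem volume_graph_eq_zero {g : ℝ → ℝ} (hg : Measurable g) :
    volume {p : ℝ × ℝ | p.2 = g p.1} = 0 := by
  rw [Measure.volume_eq_prod, Measure.measure_prod_null (measurableSet_graph hg)]
  refine Eventually.of_forall fun x => ?_
  simp

/-- `cov*(𝒩) ≥ κ*`. -/
theorem covStarN_ge_kappaStar : kappaStar ≤ covStarN := by
  refine ciSup_le' fun ⟨f, hf⟩ => le_csInf ?_ ?_
  · refine ⟨_, {H | volume H = 0}, rfl, fun H hH => hH, fun g hg B _ hB => ?_⟩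
    exact ⟨_, volume_graph_eq_zero hg, by simpa using hB.ne'⟩
  · rintro _ ⟨A, rfl, hnull, hA⟩
    choose y hy using fun H : A => exists_forall_not_REx_imp_volume_eq_zero hf (hnull H H.2)
    have hle : dNumber (REx f) ≤ #(range y) := csInf_le' ⟨range y, rfl, fun η => ?_⟩
    · exact hle.trans mk_range_le
    obtain ⟨H, hH, hne⟩ := hA _ (measurable_dyadicLimit (blockCode η)) (Ioc 0 1)
      measurableSet_Ioc (by simp)
    exact ⟨_, ⟨⟨H, hH⟩, rfl⟩, by_contra fun h => hne (hy ⟨H, hH⟩ η h)⟩
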